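/- The twenty triples (2, 4, (1,1,1,1)); (2, 6, (1,1,1,1,1,1)); (3, 4, (1,1,2,2)); (4, 4, (1,2,2,3)); (6, 4, (2,3,3,4)); (3, 5, (1,1,1,1,2)); (4, 4, (1,1,1,1)); (4, 5, (1,1,2,2,2)); (6, 4, (1,3,4,4)); (3, 6, (1,1,1,1,1,1)); (5, 4, (1,3,3,3)); (6, 4, (1,1,1,3)); (6, 4, (1,1,2,2)); (6, 5, (2,2,2,3,3)); (8, 4, (2,4,5,5)); (5, 5, (2,2,2,2,2)); (7, 4, (2,4,4,4)); (10, 4, (3,5,6,6)); (9, 4, (3,5,5,5)); (12, 4, (4,6,7,7)) are pairwise inequivalent; consequently, condition (⋆) has precisely twenty solutions up to equivalence. -/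

import Mathlib

open Finset

/-- The dimension `d_n` of the Hodge eigenspace: `d_n = (1/m)·∑_i ((n·a_i) mod m) − 1`,
where `(x mod m)` is the representative of `x` in `{0, …, m−1}` (here `Int.emod`,
which lands in `{0, …, m−1}` since `m > 0`). -/
def hodgeDim (m N : ℕ) (a : Fin N → ℤ) (n : ℤ) : ℚ :=
  ((∑ i, (n * a i) % (m : ℤ) :) : ℚ) / m - 1

/-- The hypotheses on a triple `(m, N, a)`: `m ≥ 2`, `N ≥ 4`, `1 ≤ a_i ≤ m − 1` for all `i`,
`gcd(m, a_1, …, a_N) = 1`, and `a_1 + ⋯ + a_N ≡ 0 (mod m)`. -/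
def IsTriple (m N : ℕ) (a : Fin N → ℤ) : Prop :=
  2 ≤ m ∧ 4 ≤ N ∧ (∀ i, 1 ≤ a i ∧ a i ≤ (m : ℤ) - 1) ∧
    Int.gcd (m : ℤ) (Finset.univ.gcd a) = 1 ∧ ((m : ℤ) ∣ ∑ i, a i)

/-- Condition (⋆): `N − 3 = ∑_{n=1}^{⌊(m−1)/2⌋} d_n·d_{m−n} + ε`, where
`ε = d_{m/2}(d_{m/2}+1)/2` if `m` is even and `ε = 0` if `m` is odd. -/
def CondStar (m N : ℕ) (a : Fin N → ℤ) : Prop :=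
  (N : ℚ) - 3 =
    (∑ n ∈ Finset.Icc 1 ((m - 1) / 2), hodgeDim m N a n * hodgeDim m N a ((m : ℤ) - n)) +
      if m % 2 = 0 then hodgeDim m N a (m / 2) * (hodgeDim m N a (m / 2) + 1) / 2 else 0

/-- Two `N`-tuples are equivalent (for the modulus `m`) if there is `t` with `gcd(t, m) = 1`
and a permutation `σ` with `a'_i ≡ t·a_{σ(i)} (mod m)` for all `i`. -/
def EquivTuple (m N : ℕ) (a a' : Fin N → ℤ) : Prop :=
  ∃ t : ℤ, Int.gcd t m = 1 ∧ ∃ σ : Equiv.Perm (Fin N),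
    ∀ i, a' i ≡ t * a (σ i) [ZMOD (m : ℤ)]

/-- The twenty triples, each given as the pair of `m` and the tuple `a`
(the number of branch points `N` being the length of the tuple). -/
def twentyTriples : List (ℕ × List ℕ) :=
  [(2, [1,1,1,1]), (2, [1,1,1,1,1,1]), (3, [1,1,2,2]), (4, [1,2,2,3]),
   (6, [2,3,3,4]), (3, [1,1,1,1,2]), (4, [1,1,1,1]), (4, [1,1,2,2,2]),
   (6, [1,3,4,4]), (3, [1,1,1,1,1,1]), (5, [1,3,3,3]), (6, [1,1,1,3]),
   (6, [1,1,2,2]), (6, [2,2,2,3,3]), (8, [2,4,5,5]), (5, [2,2,2,2,2]),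
   (7, [2,4,4,4]), (10, [3,5,6,6]), (9, [3,5,5,5]), (12, [4,6,7,7])]

/-- Equivalence of triples `(m, a)` (with `N` the length of the tuple): the moduli agree,
the lengths agree, and the tuples are related by a unit `t` mod `m` and a permutation. -/
def EquivTriple (p q : ℕ × List ℕ) : Prop :=
  p.1 = q.1 ∧ ∃ h : q.2.length = p.2.length,
    EquivTuple p.1 p.2.length (fun i => (p.2.get i : ℤ))
      (fun i => (q.2.get (Fin.cast h.symm i) : ℤ))

/-- For `m ∣ ∑ a i`, the integer `(1/m) ∑ ((n * a i) mod m)`. -/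
def residueSum {N : ℕ} (m : ℤ) (a : Fin N → ℤ) (n : ℤ) : ℤ := (∑ i, n * a i % m) / m

/-- Nonzero residues `a i` modulo `m` with sum zero that generate `ℤ/m`. -/
structure Admissible {N : ℕ} (m : ℤ) (a : Fin N → ℤ) : Prop where
  two_le : 2 ≤ m
  not_dvd : ∀ i, ¬ m ∣ a i
  dvd_of_forall : ∀ n, (∀ i, m ∣ n * a i) → m ∣ n
  dvd_sum : m ∣ ∑ i, a i

/-- The eigenspaces of `n` and `-n` both have positive dimension. -/
def Active {N : ℕ} (m : ℤ) (a : Fin N → ℤ) (n : ℤ) : Prop :=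
  2 ≤ residueSum m a n ∧ 2 ≤ residueSum m a (-n)

/-- Only the classes of `p` and `-p` can be active. -/
def ActiveOnly {N : ℕ} (m : ℤ) (a : Fin N → ℤ) (p : ℤ) : Prop :=
  ∀ n, Active m a n → n ≡ p [ZMOD m] ∨ n ≡ -p [ZMOD m]

namespace Admissible

variable {N : ℕ} {m : ℤ} {a : Fin N → ℤ}

theorem pos (h : Admissible m a) : 0 < m := by linarith [h.two_le]

theorem mul_residueSum (h : Admissible m a) (n : ℤ) :
    m * residueSum m a n = ∑ i, n * a i % m := by
  apply Int.mul_ediv_cancel'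
  have : ∑ i, n * a i % m = n * ∑ i, a i - m * ∑ i, n * a i / m := by
    rw [Finset.mul_sum, Finset.mul_sum, ← Finset.sum_sub_distrib]
    exact Finset.sum_congr rfl fun i _ => Int.emod_def _ _
  rw [this]
  exact dvd_sub (h.dvd_sum.mul_left _) (dvd_mul_right _ _)

theorem residueSum_congr {x y : ℤ} (hxy : x ≡ y [ZMOD m]) :
    residueSum m a x = residueSum m a y := by
  unfold residueSum
  congr 1
  exact Finset.sum_congr rfl fun i _ => hxy.mul_right (a i)

theorem residueSum_nonneg (h : Admissible m a) (n : ℤ) : 0 ≤ residueSum m a n :=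
  Int.ediv_nonneg (Finset.sum_nonneg fun _ _ => Int.emod_nonneg _ h.pos.ne') h.pos.le

theorem residueSum_pos (h : Admissible m a) {n : ℤ} (hn : ¬ m ∣ n) : 1 ≤ residueSum m a n := by
  by_contra hlt
  have h0 : residueSum m a n = 0 := by linarith [h.residueSum_nonneg n]
  have hs := h.mul_residueSum n
  rw [h0, mul_zero, eq_comm,
    Finset.sum_eq_zero_iff_of_nonneg fun _ _ => Int.emod_nonneg _ h.pos.ne'] at hs
  exact hn (h.dvd_of_forall n fun i => Int.dvd_of_emod_eq_zero (hs i (Finset.mem_univ i)))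

theorem not_dvd_of_active {n : ℤ} (hn : Active m a n) : ¬ m ∣ n := by
  intro hd
  have : residueSum m a n = residueSum m a 0 :=
    residueSum_congr ((Int.modEq_zero_iff_dvd).2 hd)
  have h0 : residueSum m a 0 = 0 := by simp [residueSum]
  have := hn.1
  omega

theorem emod_add_le (h : Admissible m a) (x y : ℤ) (i : Fin N) :
    (x + y) * a i % m ≤ x * a i % m + y * a i % m := by
  rw [add_mul, Int.add_emod, Int.emod_def (_ + _) m]
  have h1 := Int.emod_nonneg (x * a i) h.pos.ne'
  have h2 := Int.emod_nonneg (y * a i) h.pos.ne'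
  have := mul_nonneg h.pos.le (Int.ediv_nonneg (add_nonneg h1 h2) h.pos.le)
  linarith

theorem residueSum_add_le (h : Admissible m a) (x y : ℤ) :
    residueSum m a (x + y) ≤ residueSum m a x + residueSum m a y := by
  refine le_of_mul_le_mul_left ?_ h.pos
  rw [mul_add, h.mul_residueSum, h.mul_residueSum, h.mul_residueSum, ← Finset.sum_add_distrib]
  exact Finset.sum_le_sum fun i _ => h.emod_add_le x y i

theorem not_dvd_of_residueSum_add (h : Admissible m a) {x y : ℤ}
    (hxy : residueSum m a (x + y) = residueSum m a x + residueSum m a y)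
    (hy : ∀ i, ¬ m ∣ y * a i) : ∀ i, ¬ m ∣ (x + y) * a i := by
  have hle : ∀ i ∈ Finset.univ, (x + y) * a i % m ≤ x * a i % m + y * a i % m :=
    fun i _ => h.emod_add_le x y i
  have hs := congrArg (m * ·) hxy
  simp only [mul_add, h.mul_residueSum] at hs
  rw [← Finset.sum_add_distrib] at hs
  intro i hd
  have hi := (Finset.sum_eq_sum_iff_of_le hle).1 hs i (Finset.mem_univ i)
  rw [Int.emod_eq_zero_of_dvd hd] at hi
  have h1 := Int.emod_nonneg (x * a i) h.pos.ne'
  have h2 := Int.emod_nonneg (y * a i) h.pos.ne'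
  exact hy i (Int.dvd_of_emod_eq_zero (by omega))

theorem residueSum_neg (h : Admissible m a) {n : ℤ} (hn : ∀ i, ¬ m ∣ n * a i) :
    residueSum m a (-n) = N - residueSum m a n := by
  apply mul_left_cancel₀ h.pos.ne'
  rw [mul_sub, h.mul_residueSum, h.mul_residueSum, eq_sub_iff_add_eq, ← Finset.sum_add_distrib]
  rw [Finset.sum_congr rfl (g := fun _ => m), Finset.sum_const, Finset.card_univ,
    Fintype.card_fin, nsmul_eq_mul, mul_comm]
  intro i _
  have h1 := Int.emod_nonneg (n * a i) h.pos.ne'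
  have h2 := Int.emod_lt_of_pos (n * a i) h.pos
  have h3 : n * a i % m ≠ 0 := fun h0 => hn i (Int.dvd_of_emod_eq_zero h0)
  have h4 : -n * a i % m = m - n * a i % m := by
    rw [← Int.emod_eq_of_lt (a := m - n * a i % m) (b := m) (by omega) (by omega)]
    refine Int.ModEq.symm (Int.modEq_iff_dvd.2 ⟨-(n * a i / m) - 1, ?_⟩)
    linear_combination Int.emod_def (n * a i) m
  omega

theorem one_mul_not_dvd (h : Admissible m a) : ∀ i, ¬ m ∣ 1 * a i := by
  simpa using h.not_dvd

theorem mul_not_dvd (h : Admissible m a) {t : ℤ} (ht : IsCoprime t m) :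
    ∀ i, ¬ m ∣ t * a i := fun i hd => h.not_dvd i (ht.symm.dvd_of_dvd_mul_left hd)

theorem not_dvd_of_isCoprime (h : Admissible m a) {t : ℤ} (ht : IsCoprime t m) : ¬ m ∣ t := by
  intro hd
  have := Int.isUnit_iff.1 (ht.symm.isUnit_of_dvd hd)
  have := h.two_le
  omega

theorem active_of_residueSum_eq (h : Admissible m a) {n v : ℤ} (hn : ∀ i, ¬ m ∣ n * a i)
    (hv : residueSum m a n = v) (h2 : 2 ≤ v) (hN : v + 2 ≤ N) : Active m a n := by
  refine ⟨by omega, ?_⟩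
  rw [h.residueSum_neg hn]
  omega

/-- A step along which the sum is `1` reaches a value above `1` only through an active class. -/
theorem residueSum_add_eq_one (h : Admissible m a) (hN : 4 ≤ N) {x y : ℤ}
    (hx : residueSum m a x = 1) (hy : residueSum m a y = 1) (hy' : ∀ i, ¬ m ∣ y * a i)
    (hxy : ¬ m ∣ x + y) (hact : ¬ Active m a (x + y)) : residueSum m a (x + y) = 1 := by
  by_contra hne
  have h1 := h.residueSum_pos hxy
  have h2 := h.residueSum_add_le x y
  have h3 : residueSum m a (x + y) = 2 := by omega
  exact hact (h.active_of_residueSum_eq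
    (h.not_dvd_of_residueSum_add (by omega) hy') h3 le_rfl (by omega))

theorem exists_residueSum_eq (h : Admissible m a) (h1 : residueSum m a 1 = 1) {v : ℤ}
    (hv : 2 ≤ v) (hvN : v + 1 ≤ N) :
    ∃ n, 0 < n ∧ n < m ∧ residueSum m a n = v ∧ ∀ i, ¬ m ∣ n * a i := by
  have hneg : residueSum m a (-1) = N - 1 := by
    rw [h.residueSum_neg h.one_mul_not_dvd, h1]
  have hlast : residueSum m a (m - 1) = N - 1 := by
    rw [← hneg]
    exact residueSum_congr (Int.modEq_iff_dvd.2 ⟨-1, by ring⟩)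
  have hm := h.two_le
  have hex : ∃ k : ℕ, v ≤ residueSum m a k :=
    ⟨(m - 1).toNat, by rw [Int.toNat_of_nonneg (by omega), hlast]; omega⟩
  classical
  obtain ⟨k, hk, hmin⟩ : ∃ k : ℕ, v ≤ residueSum m a k ∧ ∀ j < k, residueSum m a j < v :=
    ⟨Nat.find hex, Nat.find_spec hex, fun j hj => not_le.1 (Nat.find_min hex hj)⟩
  have hkm : k ≤ (m - 1).toNat := by
    by_contra hlt
    have := hmin _ (not_le.1 hlt)
    rw [Int.toNat_of_nonneg (by omega), hlast] at this
    omega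
  have h0 : residueSum m a 0 = 0 := by simp [residueSum]
  obtain _ | k := k
  · simp [h0] at hk; omega
  have hk1 := hmin k (Nat.lt_succ_self k)
  have hle := h.residueSum_add_le k 1
  push_cast at hk
  refine ⟨k + 1, by omega, by omega, by omega, ?_⟩
  exact h.not_dvd_of_residueSum_add (by omega) h.one_mul_not_dvd

theorem residueSum_smul (t n : ℤ) :
    residueSum m (fun i => t * a i % m) n = residueSum m a (n * t) := by
  unfold residueSum
  congr 1
  refine Finset.sum_congr rfl fun i _ => ?_
  rw [mul_assoc]
  exact ((Int.mod_modEq (t * a i) m).mul_left n)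

theorem active_smul {t n : ℤ} :
    Active m (fun i => t * a i % m) n ↔ Active m a (n * t) := by
  simp only [Active, residueSum_smul, neg_mul]

theorem smul (h : Admissible m a) {t : ℤ} (ht : IsCoprime t m) :
    Admissible m (fun i => t * a i % m) where
  two_le := h.two_le
  not_dvd i hd := h.mul_not_dvd ht i ((Int.mod_modEq (t * a i) m).dvd_iff.1 hd)
  dvd_of_forall n hn := by
    refine ht.symm.dvd_of_dvd_mul_right (h.dvd_of_forall (n * t) fun i => ?_)
    rw [mul_assoc]
    exact (((Int.mod_modEq (t * a i) m).mul_left n).dvd_iff).1 (hn i)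
  dvd_sum := by
    have := h.mul_residueSum t
    exact ⟨_, this.symm⟩

theorem activeOnly_smul {t p q : ℤ} (ht : IsCoprime t m) (hq : q * t ≡ p [ZMOD m])
    (hp : ActiveOnly m a p) : ActiveOnly m (fun i => t * a i % m) q := by
  intro n hn
  have hcancel : ∀ {x y : ℤ}, x * t ≡ y * t [ZMOD m] → x ≡ y [ZMOD m] := by
    intro x y hxy
    rw [Int.modEq_iff_dvd] at hxy ⊢
    rw [← sub_mul] at hxy
    exact ht.symm.dvd_of_dvd_mul_right hxy
  refine (hp _ (active_smul.1 hn)).imp (fun h1 => hcancel (h1.trans hq.symm)) fun h1 => hcancel ?_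
  rw [neg_mul]
  exact h1.trans hq.symm.neg

/-- The product of the dimensions of the eigenspaces of `n` and `-n`. -/
def _root_.dimProd {N : ℕ} (m : ℤ) (a : Fin N → ℤ) (n : ℤ) : ℤ :=
  (residueSum m a n - 1) * (residueSum m a (-n) - 1)

theorem dimProd_congr {x y : ℤ} (hxy : x ≡ y [ZMOD m]) : dimProd m a x = dimProd m a y := by
  unfold dimProd
  rw [residueSum_congr hxy, residueSum_congr hxy.neg]

theorem dimProd_neg (x : ℤ) : dimProd m a (-x) = dimProd m a x := by
  unfold dimProd
  rw [neg_neg, mul_comm]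

theorem dimProd_nonneg (h : Admissible m a) {n : ℤ} (hn : ¬ m ∣ n) : 0 ≤ dimProd m a n :=
  mul_nonneg (by linarith [h.residueSum_pos hn])
    (by linarith [h.residueSum_pos (n := -n) (by simpa using hn)])

theorem dimProd_pos {n : ℤ} (hn : Active m a n) : 1 ≤ dimProd m a n :=
  Int.add_one_le_iff.2 (mul_pos (by linarith [hn.1]) (by linarith [hn.2]))

theorem not_dvd_of_mem {n : ℤ} (hn : n ∈ Finset.Ioo 0 m) : ¬ m ∣ n := by
  rw [Finset.mem_Ioo] at hn
  exact fun hd => absurd (Int.le_of_dvd hn.1 hd) (not_le.2 hn.2)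

theorem hodgeDim_eq {m : ℕ} (h : Admissible (m : ℤ) a) (n : ℤ) :
    hodgeDim m N a n = residueSum m a n - 1 := by
  have h0 : (m : ℚ) ≠ 0 := by exact_mod_cast h.pos.ne'
  unfold hodgeDim
  rw [← h.mul_residueSum]
  push_cast
  field_simp

theorem sum_Ioo_of_symm {m : ℕ} {g : ℤ → ℤ} (hg : ∀ n, g (m - n) = g n) :
    ∑ n ∈ Finset.Ioo 0 (m : ℤ), g n =
      2 * (∑ n ∈ Finset.Icc 1 ((m - 1) / 2), g (n : ℕ)) +
        if m % 2 = 0 ∧ 0 < m then g (m / 2) else 0 := by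
  have hlow : ∑ n ∈ Finset.Ioo 0 (m : ℤ) with 2 * n < (m : ℤ), g n =
      ∑ n ∈ Finset.Icc 1 ((m - 1) / 2), g (n : ℕ) := by
    refine Finset.sum_nbij' Int.toNat Nat.cast ?_ ?_ ?_ ?_ ?_ <;> intro n hn <;>
      simp only [Finset.mem_filter, Finset.mem_Ioo, Finset.mem_Icc] at hn ⊢
    · omega
    · omega
    · omega
    · simp
    · rw [Int.toNat_of_nonneg (by omega)]
  have hhigh : ∑ n ∈ Finset.Ioo 0 (m : ℤ) with ¬ 2 * n < (m : ℤ) ∧ ¬ 2 * n = (m : ℤ), g n =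
      ∑ n ∈ Finset.Ioo 0 (m : ℤ) with 2 * n < (m : ℤ), g n := by
    refine Finset.sum_nbij' (m - ·) (m - ·) ?_ ?_ ?_ ?_ ?_ <;> intro n hn <;>
      simp only [Finset.mem_filter, Finset.mem_Ioo] at hn ⊢
    · omega
    · omega
    · omega
    · omega
    · exact (hg n).symm
  have hmid : ∑ n ∈ Finset.Ioo 0 (m : ℤ) with ¬ 2 * n < (m : ℤ) ∧ 2 * n = (m : ℤ), g n =
      if m % 2 = 0 ∧ 0 < m then g (m / 2) else 0 := by
    split_ifs with hm
    · rw [← Finset.sum_singleton g]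
      refine Finset.sum_congr ?_ fun _ _ => rfl
      ext n
      simp only [Finset.mem_filter, Finset.mem_Ioo, Finset.mem_singleton]
      omega
    · rw [Finset.filter_false_of_mem, Finset.sum_empty]
      intro n hn
      rw [Finset.mem_Ioo] at hn
      omega
  rw [← Finset.sum_filter_add_sum_filter_not _ (fun n => 2 * n < (m : ℤ)),
    ← Finset.sum_filter_add_sum_filter_not (Finset.filter (fun n => ¬ 2 * n < (m : ℤ)) _)
      (fun n => 2 * n = (m : ℤ)), Finset.filter_filter, Finset.filter_filter, hmid, hhigh, hlow]
  ring

theorem sum_dimProd {m : ℕ} (h : Admissible (m : ℤ) a) (hs : CondStar m N a) :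
    ∑ n ∈ Finset.Ioo 0 (m : ℤ), dimProd m a n +
      (if m % 2 = 0 then residueSum m a (m / 2) - 1 else 0) = 2 * ((N : ℤ) - 3) := by
  have hm := h.two_le
  have hneg : ∀ n : ℤ, residueSum m a (m - n) = residueSum m a (-n) := fun n =>
    residueSum_congr (Int.modEq_iff_dvd.2 ⟨-1, by ring⟩)
  have hsym : ∀ n : ℤ, dimProd m a (m - n) = dimProd m a n := fun n => by
    rw [← dimProd_neg n]
    exact dimProd_congr (Int.modEq_iff_dvd.2 ⟨-1, by ring⟩)
  rw [sum_Ioo_of_symm hsym]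
  unfold CondStar at hs
  simp only [h.hodgeDim_eq, hneg] at hs
  have hsum : (∑ n ∈ Finset.Icc 1 ((m - 1) / 2),
      ((residueSum m a (n : ℕ) : ℚ) - 1) * ((residueSum m a (-(n : ℕ)) : ℚ) - 1)) =
      ((∑ n ∈ Finset.Icc 1 ((m - 1) / 2), dimProd m a (n : ℕ) : ℤ) : ℚ) := by
    push_cast [dimProd]
    rfl
  rw [hsum] at hs
  by_cases h2 : m % 2 = 0
  · have hmid : dimProd m a (m / 2) = (residueSum m a (m / 2) - 1) ^ 2 := by
      have : residueSum m a (-((m : ℤ) / 2)) = residueSum m a (m / 2) :=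
        residueSum_congr (Int.modEq_iff_dvd.2 ⟨1, by omega⟩)
      rw [dimProd, this, sq]
    rw [if_pos h2] at hs ⊢
    rw [if_pos ⟨h2, by omega⟩, hmid]
    qify
    push_cast at hs
    linear_combination -2 * hs
  · rw [if_neg h2] at hs ⊢
    rw [if_neg fun hc => h2 hc.1]
    qify
    push_cast at hs
    linear_combination -2 * hs

/-- A class with values `2` and `N - 2` exhausts the equation, so no other class is active. -/
theorem activeOnly {m : ℕ} (h : Admissible (m : ℤ) a)
    (hs : CondStar m N a) {p : ℤ} (hp : p ∈ Finset.Ioo 0 (m : ℤ))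
    (hp2 : residueSum m a p = 2) (hpz : ∀ i, ¬ (m : ℤ) ∣ p * a i) : ActiveOnly m a p := by
  intro n hn
  by_contra! hne
  have hsum := h.sum_dimProd hs
  have hm := h.pos
  have hr := Int.mod_modEq n m
  set r := n % (m : ℤ)
  have hWr : 1 ≤ dimProd m a r := dimProd_congr hr ▸ dimProd_pos hn
  have hWr' : 1 ≤ dimProd m a (m - r) := by
    rwa [dimProd_congr (Int.modEq_iff_dvd.2 ⟨-1, by ring⟩ : (m : ℤ) - r ≡ -r [ZMOD m]), dimProd_neg]
  have hnp := h.residueSum_neg hpz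
  have hWp : dimProd m a p = (N : ℤ) - 3 := by
    rw [dimProd, hnp, hp2]; ring
  have hWp' : dimProd m a (m - p) = (N : ℤ) - 3 := by
    rwa [dimProd_congr (Int.modEq_iff_dvd.2 ⟨-1, by ring⟩ : (m : ℤ) - p ≡ -p [ZMOD m]), dimProd_neg]
  have hr0 : 0 < r := lt_of_le_of_ne (Int.emod_nonneg _ hm.ne') fun h0 =>
    not_dvd_of_active hn (Int.dvd_of_emod_eq_zero h0.symm)
  have hrm : r < m := Int.emod_lt_of_pos _ hm
  have hrp : r ≠ p := fun e => hne.1 (e ▸ hr.symm)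
  have hrp' : r ≠ m - p := fun e => hne.2 (hr.symm.trans
    (e ▸ Int.modEq_iff_dvd.2 ⟨-1, by ring⟩))
  rw [Finset.mem_Ioo] at hp
  have hsub : ∀ s ⊆ Finset.Ioo 0 (m : ℤ), ∑ n ∈ s, dimProd m a n ≤
      ∑ n ∈ Finset.Ioo 0 (m : ℤ), dimProd m a n := fun s hs =>
    Finset.sum_le_sum_of_subset_of_nonneg hs fun n hn _ =>
      h.dimProd_nonneg (not_dvd_of_mem hn)
  by_cases hpm : p = m - p
  · have h3 := hsub {p, r, m - r} (by
      intro x hx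
      simp only [Finset.mem_insert, Finset.mem_singleton] at hx
      rw [Finset.mem_Ioo]
      omega)
    rw [Finset.sum_insert (by simp; omega), Finset.sum_pair (by omega)] at h3
    have hmid : (m : ℤ) / 2 = p := by omega
    have h4 : residueSum m a (-p) = residueSum m a p :=
      residueSum_congr (Int.modEq_iff_dvd.2 ⟨1, by omega⟩)
    rw [hmid, if_pos (by omega)] at hsum
    omega
  · have h3 := hsub {p, m - p, r} (by
      intro x hx
      simp only [Finset.mem_insert, Finset.mem_singleton] at hx
      rw [Finset.mem_Ioo]
      omega)
    rw [Finset.sum_insert (by simp; omega), Finset.sum_pair (by omega)] at h3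
    have h5 : 0 ≤ if m % 2 = 0 then residueSum m a (m / 2) - 1 else 0 := by
      split_ifs with h2
      · have := h.residueSum_pos (n := (m : ℤ) / 2)
          (not_dvd_of_mem (Finset.mem_Ioo.2 ⟨by omega, by omega⟩))
        omega
      · rfl
    omega

end Admissible

/-- The lists of positive integers at most `k` with sum `s`, in decreasing order. -/
def boundedPartitions : ℕ → ℕ → List (List ℕ)
  | 0, s => if s = 0 then [[]] else []
  | k + 1, s => (List.range (s / (k + 1) + 1)).flatMap fun c =>
      (boundedPartitions k (s - c * (k + 1))).map (List.replicate c (k + 1) ++ ·)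

/-- `residueSum` for a list of natural numbers. -/
def listResidueSum (m : ℕ) (l : List ℕ) (n : ℕ) : ℕ := (l.map (n * · % m)).sum / m

/-- For a list of natural numbers: no residue sum vanishes, and only `p` and `m - p` are
active. -/
def listActiveOnly (m : ℕ) (l : List ℕ) (p : ℕ) : Bool :=
  (List.range m).all fun n => n == 0 || (1 ≤ listResidueSum m l n && (n == p || m - n == p ||
    listResidueSum m l n ≤ 1 || listResidueSum m l (m - n) ≤ 1))

/-- The list is, up to order and multiplication by a unit, one of the twenty tuples. -/
def inTwentyTriples (m : ℕ) (l : List ℕ) : Bool :=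
  twentyTriples.any fun p => p.1 == m &&
    (List.range m).any fun t => Nat.gcd t m == 1 && (l.map (t * · % m)).isPerm p.2

theorem inTwentyTriples_of_sum_eq_two_mul :
    ∀ m ∈ [2, 3, 4, 6], ∀ l ∈ boundedPartitions (m - 1) (2 * m), 4 ≤ l.length →
      listActiveOnly m l 1 → inTwentyTriples m l := by
  decide +kernel

theorem inTwentyTriples_of_sum_eq :
    ∀ m ∈ List.range 13, ∀ l ∈ boundedPartitions (m - 1) m, 4 ≤ l.length → l.length ≤ 5 →
      ∀ p ∈ List.range m, listActiveOnly m l p → inTwentyTriples m l := by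
  decide +kernel

/-- Every `j < K` coprime to `m` divides `K` or `m - K`. -/
def coprimesDivide (K m : ℕ) : Bool :=
  (List.range K).all fun j => j == 0 || K % j == 0 || (m - K) % j == 0 || Nat.gcd j m != 1

/-- No tuple `(m - b - c - d - e, b, c, d, e)` with small `c` has only `K` active. -/
def noLongTuple (K m : ℕ) : Bool :=
  (List.range (m / K + 1)).all fun c => c == 0 || m ≤ c * K ||
    (List.range (c + 1)).all fun d => d == 0 ||
      (List.range (d + 1)).all fun e =>
        (List.range (m / 2 + 1 - c)).all fun b => b < c || m < 2 * (b + c + d + e) ||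
          !listActiveOnly m [m - b - c - d - e, b, c, d, e] K

theorem noLongTuple_of_coprimesDivide :
    ∀ K ∈ List.range 47, 3 ≤ K → ∀ m ∈ List.range (6 * K + 1), 13 ≤ m → 2 * K ≤ m →
      coprimesDivide K m → noLongTuple K m := by
  decide +kernel

theorem isPerm_eq_of_mem_twentyTriples :
    ∀ p ∈ twentyTriples, ∀ q ∈ twentyTriples, p.1 = q.1 → ∀ t ∈ List.range p.1,
      Nat.gcd t p.1 = 1 → (p.2.map (t * · % p.1)).isPerm q.2 → p = q := by
  decide +kernel

theorem exists_mem_boundedPartitions (k : ℕ) : ∀ s : Multiset ℕ, (∀ x ∈ s, 1 ≤ x ∧ x ≤ k) →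
    ∃ l ∈ boundedPartitions k s.sum, (l : Multiset ℕ) = s := by
  induction k with
  | zero =>
    intro s hs
    have : s = 0 := Multiset.eq_zero_of_forall_notMem fun x hx => by
      have := hs x hx
      omega
    subst this
    exact ⟨[], by simp [boundedPartitions], rfl⟩
  | succ k ih =>
    intro s hs
    obtain ⟨l, hl, hls⟩ := ih (s.filter (k + 1 ≠ ·)) fun x hx => by
      rw [Multiset.mem_filter] at hx
      have := hs x hx.1
      omega
    have hdecomp : Multiset.replicate (s.count (k + 1)) (k + 1) + s.filter (k + 1 ≠ ·) = s := by
      rw [← Multiset.filter_eq]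
      exact Multiset.filter_add_not _ s
    have hsum := congrArg Multiset.sum hdecomp
    rw [Multiset.sum_add, Multiset.sum_replicate, smul_eq_mul] at hsum
    refine ⟨List.replicate (s.count (k + 1)) (k + 1) ++ l, ?_, ?_⟩
    · rw [boundedPartitions, List.mem_flatMap]
      refine ⟨s.count (k + 1), ?_, List.mem_map.2 ⟨l, ?_, rfl⟩⟩
      · rw [List.mem_range, Nat.lt_succ_iff, Nat.le_div_iff_mul_le (Nat.succ_pos k), ← hsum]
        exact Nat.le_add_right _ _
      · rwa [← hsum, Nat.add_sub_cancel_left]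
    · rw [← Multiset.coe_add, hls, Multiset.coe_replicate, hdecomp]

/-- Families with the same multiset of values agree up to a permutation of the indices. -/
theorem exists_perm_of_map_eq {N : ℕ} {α : Type*} [LinearOrder α] {f g : Fin N → α}
    (h : Finset.univ.val.map f = Finset.univ.val.map g) :
    ∃ σ : Equiv.Perm (Fin N), ∀ i, g i = f (σ i) := by
  have hsort (u : Fin N → α) :
      List.ofFn (u ∘ Tuple.sort u) = (Finset.univ.val.map u).sort := by
    refine List.Perm.eq_of_pairwise' (r := (· ≤ ·))
      (List.sortedLE_ofFn_iff.2 (Tuple.monotone_sort u)).pairwise (Multiset.pairwise_sort _ _) ?_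
    rw [← Multiset.coe_eq_coe, Multiset.sort_eq, ← Multiset.map_univ_val_equiv (Tuple.sort u),
      Multiset.map_map, Fin.univ_val_map]
  have heq : f ∘ Tuple.sort f = g ∘ Tuple.sort g :=
    List.ofFn_injective (by rw [hsort, hsort, h])
  refine ⟨(Tuple.sort g).symm.trans (Tuple.sort f), fun i => ?_⟩
  have := congrFun heq ((Tuple.sort g).symm i)
  simpa using this.symm

/-- The values of `a` are those of the list `l`, in some order. -/
def IsListing {N : ℕ} (a : Fin N → ℤ) (l : List ℕ) : Prop :=
  Finset.univ.val.map a = ((l.map Nat.cast : List ℤ) : Multiset ℤ)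

/-- The tuple `a` is equivalent to one of the twenty tuples, with `l` its values modulo `m`. -/
def IsKnown {N : ℕ} (m : ℕ) (a : Fin N → ℤ) : Prop :=
  ∃ p ∈ twentyTriples, p.1 = m ∧
    ∃ t : ℤ, IsCoprime t m ∧ IsListing (fun i => t * a i % m) p.2

namespace IsListing

variable {N : ℕ} {a : Fin N → ℤ} {l : List ℕ}

theorem length_eq (hl : IsListing a l) : l.length = N := by
  simpa [eq_comm] using congrArg Multiset.card hl

theorem sum_eq (hl : IsListing a l) : (l.sum : ℤ) = ∑ i, a i := by
  have := congrArg Multiset.sum hl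
  rw [Multiset.sum_coe, ← Nat.cast_list_sum] at this
  exact this.symm

theorem map_mul_emod (hl : IsListing a l) (m n : ℕ) :
    IsListing (fun i => n * a i % m) (l.map (n * · % m)) := by
  have := congrArg (Multiset.map fun x : ℤ => n * x % m) hl
  rw [Multiset.map_map, Multiset.map_coe] at this
  unfold IsListing
  rw [show ((l.map (n * · % m)).map Nat.cast : List ℤ) =
    (l.map Nat.cast).map (fun x : ℤ => n * x % m) by simp]
  exact this

theorem residueSum_eq (hl : IsListing a l) (m n : ℕ) :
    residueSum m a n = listResidueSum m l n := by
  rw [residueSum, listResidueSum, ← (hl.map_mul_emod m n).sum_eq]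
  exact (Int.natCast_ediv _ _).symm

theorem isKnown {m : ℕ} (hl : IsListing a l) (h : inTwentyTriples m l) : IsKnown m a := by
  simp only [inTwentyTriples, List.any_eq_true, Bool.and_eq_true, beq_iff_eq] at h
  obtain ⟨p, hp, hpm, t, -, ht, hperm⟩ := h
  refine ⟨p, hp, hpm, t, Nat.isCoprime_iff_coprime.2 ht, ?_⟩
  rw [IsListing, hl.map_mul_emod m t]
  exact Multiset.coe_eq_coe.2 ((List.isPerm_iff.1 hperm).map _)

/-- A tuple of integers in `[1, k]` is listed by a bounded partition. -/
theorem exists_mem_boundedPartitions {k : ℕ} (ha : ∀ i, 1 ≤ a i ∧ a i ≤ k) {s : ℕ}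
    (hs : ∑ i, a i = s) : ∃ l ∈ boundedPartitions k s, IsListing a l := by
  obtain ⟨l, hl, hls⟩ := _root_.exists_mem_boundedPartitions k
    (Finset.univ.val.map fun i => (a i).toNat) fun x hx => by
      obtain ⟨i, -, rfl⟩ := Multiset.mem_map.1 hx
      have := ha i
      omega
  have hlist : IsListing a l := by
    rw [IsListing, ← Multiset.map_coe, hls, Multiset.map_map]
    refine Multiset.map_congr rfl fun i _ => ?_
    have := ha i
    simp only [Function.comp_apply]
    omega
  refine ⟨l, ?_, hlist⟩
  rwa [← hls, Multiset.sum_coe, show l.sum = s by exact_mod_cast hlist.sum_eq.trans hs] at hl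

end IsListing

theorem IsKnown.of_smul {N m : ℕ} {a : Fin N → ℤ} {t : ℤ} (ht : IsCoprime t m)
    (h : IsKnown m fun i => t * a i % m) : IsKnown m a := by
  obtain ⟨p, hp, hpm, u, hu, hl⟩ := h
  refine ⟨p, hp, hpm, u * t, hu.mul_left ht, ?_⟩
  rw [IsListing, ← hl]
  refine Multiset.map_congr rfl fun i _ => ?_
  rw [mul_assoc]
  exact ((Int.mod_modEq _ _).mul_left u).symm

theorem ActiveOnly.eq_or_eq {N : ℕ} {a : Fin N → ℤ} {m p n : ℤ} (hact : ActiveOnly m a p)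
    (hp : 0 < p) (hpm : p < m) (hn : 0 < n) (hnm : n < m) (h : Active m a n) :
    n = p ∨ n = m - p := by
  refine (hact n h).imp (fun hc => ?_) fun hc => ?_
  · exact (Int.emod_eq_of_lt hn.le hnm).symm.trans (Eq.trans hc (Int.emod_eq_of_lt hp.le hpm))
  · have hc' : n ≡ m - p [ZMOD m] := hc.trans (Int.modEq_iff_dvd.2 ⟨1, by ring⟩)
    exact (Int.emod_eq_of_lt hn.le hnm).symm.trans
      (Eq.trans hc' (Int.emod_eq_of_lt (by omega) (by omega)))

theorem Admissible.listActiveOnly {N m p : ℕ} {a : Fin N → ℤ} (h : Admissible m a)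
    (hact : ActiveOnly m a p) (hp : 0 < p) (hpm : p < m) {l : List ℕ}
    (hl : ∀ n : ℕ, residueSum m a n = listResidueSum m l n) : listActiveOnly m l p := by
  simp only [_root_.listActiveOnly, List.all_eq_true, List.mem_range, Bool.or_eq_true,
    Bool.and_eq_true, beq_iff_eq, decide_eq_true_eq]
  intro n hn
  rw [or_iff_not_imp_left]
  intro hn0
  have hndvd : ¬ (m : ℤ) ∣ n := fun hd =>
    hn0 (Nat.eq_zero_of_dvd_of_lt (Int.natCast_dvd_natCast.1 hd) hn)
  have h1 := h.residueSum_pos hndvd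
  refine ⟨by rw [hl] at h1; exact_mod_cast h1, ?_⟩
  by_contra hcon
  push Not at hcon
  obtain ⟨⟨⟨hnp, hmnp⟩, h2⟩, h3⟩ := hcon
  have hneg : residueSum m a (-n) = residueSum m a ((m - n : ℕ) : ℤ) :=
    Admissible.residueSum_congr (Int.modEq_iff_dvd.2 ⟨1, by push_cast [hn.le]; ring⟩)
  have := hact.eq_or_eq (by omega) (by omega) (n := n) (by omega) (by omega)
    ⟨by rw [hl]; exact_mod_cast h2, by rw [hneg, hl]; exact_mod_cast h3⟩
  omega

/-- A residue coprime to `M` in the range `[M / 6, M / 2]`. -/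
theorem exists_coprime_mem_Icc {M : ℕ} (hM : 2 ≤ M) :
    ∃ k, 1 ≤ k ∧ Nat.Coprime k M ∧ M ≤ 6 * k ∧ 2 * k ≤ M ∧ (M ∉ [2, 3, 4, 6] → 2 ≤ k) := by
  have h2 (k : ℕ) (hk : k % 2 = 1) : Nat.Coprime k 2 := by
    rwa [Nat.coprime_comm, Nat.Prime.coprime_iff_not_dvd Nat.prime_two, Nat.two_dvd_ne_zero]
  by_cases hM6 : M = 2 ∨ M = 6
  · exact ⟨1, le_rfl, Nat.coprime_one_left M, by omega, by omega, by simp; omega⟩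
  obtain h | h | h : M % 2 = 1 ∨ M % 4 = 0 ∨ M % 4 = 2 := by omega
  · obtain ⟨k, rfl⟩ : ∃ k, M = k * 2 + 1 := ⟨M / 2, by omega⟩
    refine ⟨k, by omega, ?_, by omega, by omega, by simp; omega⟩
    simp
  · obtain ⟨k, rfl⟩ : ∃ k, M = k * 2 + 2 := ⟨M / 2 - 1, by omega⟩
    refine ⟨k, by omega, ?_, by omega, by omega, by simp; omega⟩
    simpa using h2 k (by omega)
  · obtain ⟨k, rfl⟩ : ∃ k, M = k * 2 + 2 ^ 2 := ⟨M / 2 - 2, by omega⟩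
    refine ⟨k, by omega, ?_, by omega, by omega, by simp; omega⟩
    rw [Nat.coprime_mul_left_add_right]
    exact (h2 k (by omega)).pow_right 2

namespace Admissible

variable {N m : ℕ} {a : Fin N → ℤ}

theorem exists_isListing (h : Admissible m a) {t : ℤ} (ht : IsCoprime t m) {v : ℕ}
    (hv : residueSum m a t = v) :
    ∃ l ∈ boundedPartitions (m - 1) (m * v), IsListing (fun i => t * a i % m) l := by
  apply IsListing.exists_mem_boundedPartitions
  · intro i
    have h1 := Int.emod_nonneg (t * a i) h.pos.ne'
    have h2 := Int.emod_lt_of_pos (t * a i) h.pos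
    have h3 : t * a i % m ≠ 0 := fun h0 => h.mul_not_dvd ht i (Int.dvd_of_emod_eq_zero h0)
    omega
  · rw [← h.mul_residueSum, hv, Nat.cast_mul]

theorem isKnown_of_residueSum_eq_two (h : Admissible m a) (hN : 4 ≤ N)
    (hm : m ∈ [2, 3, 4, 6]) {t : ℤ} (ht : IsCoprime t m) (hF : residueSum m a t = 2)
    (hact : ActiveOnly m a t) : IsKnown m a := by
  obtain ⟨l, hl, hla⟩ := h.exists_isListing ht (v := 2) hF
  have hm2 := h.two_le
  refine IsKnown.of_smul ht (hla.isKnown (inTwentyTriples_of_sum_eq_two_mul m hm l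
    (by rwa [mul_comm]) (by rwa [hla.length_eq]) ?_))
  exact (h.smul ht).listActiveOnly (activeOnly_smul ht (by rw [Nat.cast_one, one_mul]) hact)
    one_pos (by omega) (hla.residueSum_eq m)

/-- If every eigenspace of a primitive character has dimension at least two, then few residues
are coprime to `m`. -/
theorem isKnown_of_forall_residueSum_ne_one (h : Admissible m a) (hN : 4 ≤ N)
    (hs : CondStar m N a) (hne : ∀ t : ℤ, IsCoprime t m → residueSum m a t ≠ 1) :
    IsKnown m a := by
  have hm2 : 2 ≤ m := by exact_mod_cast h.two_le
  have hunit (t : ℤ) (ht : IsCoprime t m) : 2 ≤ residueSum m a t ∧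
      2 ≤ residueSum m a (-t) ∧ residueSum m a (-t) = N - residueSum m a t := by
    have h1 := h.residueSum_pos (h.not_dvd_of_isCoprime ht)
    have h2 := h.residueSum_pos (h.not_dvd_of_isCoprime ht.neg_left)
    have h3 := hne t ht
    have h4 := hne (-t) ht.neg_left
    exact ⟨by omega, by omega, h.residueSum_neg (h.mul_not_dvd ht)⟩
  have hprod (t : ℤ) (ht : IsCoprime t m) : (N : ℤ) - 3 ≤ dimProd m a t := by
    obtain ⟨h1, h2, h3⟩ := hunit t ht
    rw [dimProd]
    nlinarith
  have hlast : dimProd m a (m - 1) = dimProd m a 1 := by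
    rw [← dimProd_neg 1]
    exact dimProd_congr (Int.modEq_iff_dvd.2 ⟨-1, by ring⟩)
  have hsum := h.sum_dimProd hs
  have hnonneg : ∀ n ∈ Finset.Ioo 0 (m : ℤ), 0 ≤ dimProd m a n :=
    fun n hn => h.dimProd_nonneg (not_dvd_of_mem hn)
  have heps : 0 ≤ if m % 2 = 0 then residueSum m a (m / 2) - 1 else 0 := by
    split_ifs with h2
    · have := h.residueSum_pos (n := m / 2) (not_dvd_of_mem (by rw [Finset.mem_Ioo]; omega))
      omega
    · exact le_rfl
  have hle (s : Finset ℤ) (hsub : s ⊆ Finset.Ioo 0 (m : ℤ)) :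
      ∑ n ∈ s, dimProd m a n ≤ 2 * ((N : ℤ) - 3) := by
    have := Finset.sum_le_sum_of_subset_of_nonneg hsub fun n hn _ => hnonneg n hn
    omega
  have hmem : m ∈ [2, 3, 4, 6] := by
    by_contra hmem
    obtain ⟨k, -, hk, -, hkm, hk2⟩ := exists_coprime_mem_Icc hm2
    have hk2 := hk2 hmem
    have hm5 : m ≠ 4 := by
      rintro rfl
      simp at hmem
    have := hle {1, (m : ℤ) - 1, (k : ℤ)} (by
      intro n hn
      simp only [Finset.mem_insert, Finset.mem_singleton] at hn
      rw [Finset.mem_Ioo]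
      omega)
    rw [Finset.sum_insert (by simp; omega), Finset.sum_insert (by simp; omega),
      Finset.sum_singleton, hlast] at this
    have := hprod 1 isCoprime_one_left
    have := hprod k (Nat.isCoprime_iff_coprime.2 hk)
    omega
  obtain ⟨h1, h2, h3⟩ := hunit 1 isCoprime_one_left
  by_cases hm : m = 2
  · subst hm
    have hIoo : Finset.Ioo 0 ((2 : ℕ) : ℤ) = {1} := by decide
    have hneg : residueSum (2 : ℕ) a (-1) = residueSum (2 : ℕ) a 1 :=
      residueSum_congr (Int.modEq_iff_dvd.2 ⟨1, by norm_num⟩)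
    rw [hIoo, Finset.sum_singleton, dimProd, hneg] at hsum
    simp only [Nat.mod_self, if_true, Nat.cast_ofNat,
      Int.ediv_self (show (2 : ℤ) ≠ 0 by norm_num)] at hsum hneg h1 h2 h3
    have hroot : (residueSum 2 a 1 - 2) * (residueSum 2 a 1 - 3) = 0 := by
      have hN2 : (N : ℤ) = 2 * residueSum 2 a 1 := by omega
      rw [hN2] at hsum
      linear_combination hsum
    rcases mul_eq_zero.1 hroot with hr | hr
    · have hF : residueSum (2 : ℕ) a 1 = 2 := by simp only [Nat.cast_ofNat]; omega
      exact h.isKnown_of_residueSum_eq_two hN hmem isCoprime_one_left hF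
        (h.activeOnly hs (by decide) hF h.one_mul_not_dvd)
    · obtain ⟨l, hl, hla⟩ := h.exists_isListing (t := 1) isCoprime_one_left (v := 3)
        (by simp only [Nat.cast_ofNat]; omega)
      have : ∀ l ∈ boundedPartitions (2 - 1) (2 * 3), inTwentyTriples 2 l := by decide +kernel
      exact IsKnown.of_smul isCoprime_one_left (hla.isKnown (this l hl))
  · have := hle {1, (m : ℤ) - 1} (by
      intro n hn
      simp only [Finset.mem_insert, Finset.mem_singleton] at hn
      rw [Finset.mem_Ioo]
      omega)
    rw [Finset.sum_insert (by simp; omega), Finset.sum_singleton, hlast, dimProd, h3] at this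
    have hor : residueSum m a 1 = 2 ∨ residueSum m a (-1) = 2 := by
      by_contra hcon
      push Not at hcon
      have h4 : 3 ≤ residueSum m a 1 := by omega
      have h5 : 3 ≤ residueSum m a (-1) := by omega
      rw [h3] at h5
      nlinarith
    rcases hor with hF | hF
    · exact h.isKnown_of_residueSum_eq_two hN hmem isCoprime_one_left hF
        (h.activeOnly hs (by rw [Finset.mem_Ioo]; omega) hF h.one_mul_not_dvd)
    · have hcop : IsCoprime ((m : ℤ) - 1) m := ⟨-1, 1, by ring⟩
      have hF' : residueSum m a ((m : ℤ) - 1) = 2 := by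
        rw [← hF]
        exact residueSum_congr (Int.modEq_iff_dvd.2 ⟨-1, by ring⟩)
      exact h.isKnown_of_residueSum_eq_two hN hmem hcop hF'
        (h.activeOnly hs (by rw [Finset.mem_Ioo]; omega) hF' (h.mul_not_dvd hcop))

end Admissible

namespace Admissible

variable {N m : ℕ} {a : Fin N → ℤ}

theorem exists_activeOnly_smul (h : Admissible m a) (hN : 4 ≤ N) (hs : CondStar m N a) {t : ℤ}
    (ht : IsCoprime t m) (hF : residueSum m a t = 1) :
    N ≤ 5 ∧ ∃ p : ℕ, 0 < p ∧ p < m ∧ ActiveOnly m (fun i => t * a i % m) p := by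
  have hb := h.smul ht
  have hb1 : residueSum m (fun i => t * a i % m) 1 = 1 := by rw [residueSum_smul, one_mul, hF]
  obtain ⟨p, hp0, hpm, hp2, hpz⟩ := hb.exists_residueSum_eq hb1 le_rfl (by omega)
  have hpt : p * t ≡ p * t % m [ZMOD m] := (Int.mod_modEq _ _).symm
  have hz : ∀ i, ¬ (m : ℤ) ∣ p * t % m * a i := fun i hd => by
    refine hpz i (Int.modEq_zero_iff_dvd.1 ?_)
    refine ((Int.mod_modEq _ _).mul_left p).trans ?_
    rw [← mul_assoc]
    exact (hpt.mul_right (a i)).trans (Int.modEq_zero_iff_dvd.2 hd)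
  have hmem : p * t % m ∈ Finset.Ioo 0 (m : ℤ) := by
    have h1 := Int.emod_nonneg (p * t) h.pos.ne'
    have h2 := Int.emod_lt_of_pos (p * t) h.pos
    have h3 : p * t % m ≠ 0 := fun h0 => hz ⟨0, by omega⟩ (by simp [h0])
    rw [Finset.mem_Ioo]
    omega
  have hact := h.activeOnly hs hmem
    (by rw [← residueSum_congr hpt, ← residueSum_smul, hp2]) hz
  have hact' := activeOnly_smul ht hpt hact
  constructor
  · by_contra hN5
    obtain ⟨n, -, -, hn3, hnz⟩ := hb.exists_residueSum_eq hb1 (v := 3) (by omega) (by omega)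
    have hneg := hb.residueSum_neg hpz
    rcases hact' n (hb.active_of_residueSum_eq hnz hn3 (by omega) (by omega)) with hc | hc <;>
    · rw [residueSum_congr hc] at hn3
      omega
  · lift p to ℕ using hp0.le
    exact ⟨p, by omega, by omega, hact'⟩

/-- Multiplying by a suitable unit moves the active class into `[m / 6, m / 2]`. -/
theorem exists_activeOnly_mem_Icc (h : Admissible m a) {p : ℕ} (hp : 0 < p) (hpm : p < m)
    (hact : ActiveOnly m a p) (hm : 13 ≤ m) :
    ∃ (t : ℤ) (K : ℕ), IsCoprime t m ∧ residueSum m a t = 1 ∧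
      ActiveOnly m (fun i => t * a i % m) K ∧ 2 * K ≤ m ∧ m ≤ 6 * K := by
  obtain ⟨g, p', M, hg, hcop, rfl, rfl⟩ := Nat.exists_coprime' (Nat.gcd_pos_of_pos_left m hp)
  have hM : 2 ≤ M := by
    have := Nat.lt_of_mul_lt_mul_right hpm
    have := Nat.pos_of_mul_pos_right hp
    omega
  obtain ⟨k, hk1, hk, hk6, hk2, -⟩ := exists_coprime_mem_Icc hM
  have : NeZero (M * g) := ⟨by omega⟩
  obtain ⟨w, hw⟩ := ZMod.unitsMap_surjective (Dvd.intro g rfl : M ∣ M * g)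
    (ZMod.unitOfCoprime p' hcop * (ZMod.unitOfCoprime k hk)⁻¹)
  have hK6 : M * g ≤ 6 * (k * g) := by
    rw [← mul_assoc]
    exact Nat.mul_le_mul_right g hk6
  have hK2 : 2 * (k * g) ≤ M * g := by
    rw [← mul_assoc]
    exact Nat.mul_le_mul_right g hk2
  obtain ⟨u, hu, hkp⟩ : ∃ u : ℤ, IsCoprime u (M * g : ℕ) ∧
      ((k * g : ℕ) : ℤ) * u ≡ (p' * g : ℕ) [ZMOD (M * g : ℕ)] := by
    refine ⟨(w : ZMod (M * g)).val, Nat.isCoprime_iff_coprime.2 (ZMod.val_coe_unit_coprime w), ?_⟩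
    have h1 : (k : ℤ) * (w : ZMod (M * g)).val ≡ p' [ZMOD M] := by
      rw [← ZMod.intCast_eq_intCast_iff]
      have h2 := congrArg Units.val (eq_mul_inv_iff_mul_eq.1 hw)
      simp only [Units.val_mul, ZMod.unitsMap_val, ZMod.coe_unitOfCoprime] at h2
      push_cast
      rw [mul_comm, ← h2, ZMod.natCast_val]
    have h2 := h1.mul_right' (c := (g : ℤ))
    push_cast
    convert h2 using 1
    ring
  have hnot : ¬ Active (M * g : ℕ) a u := by
    intro hc
    have hdvd (e : ℤ) (he : ((k * g : ℕ) : ℤ) * u ≡ e * u [ZMOD (M * g : ℕ)]) :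
        ((M * g : ℕ) : ℤ) ∣ e - (k * g : ℕ) := by
      refine hu.symm.dvd_of_dvd_mul_right ?_
      rw [sub_mul]
      exact Int.modEq_iff_dvd.1 he
    rcases hact u hc with hc | hc
    · have := Int.le_of_dvd (by omega)
        ((dvd_neg (α := ℤ)).2 (hdvd 1 (by simpa using hkp.trans hc.symm)))
      omega
    · have := Int.le_of_dvd (by omega)
        ((dvd_neg (α := ℤ)).2 (hdvd (-1) (by simpa using hkp.trans (by simpa using hc.symm.neg))))
      omega
  by_cases hu1 : residueSum (M * g : ℕ) a u = 1
  · exact ⟨u, k * g, hu, hu1, activeOnly_smul hu hkp hact, hK2, hK6⟩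
  · have hneg : residueSum (M * g : ℕ) a (-u) = 1 := by
      have h1 := h.residueSum_pos (h.not_dvd_of_isCoprime hu)
      have h2 := h.residueSum_pos (h.not_dvd_of_isCoprime hu.neg_left)
      by_contra hne
      exact hnot ⟨by omega, by omega⟩
    have hact' : ActiveOnly (M * g : ℕ) a (-(p' * g : ℕ)) := fun n hn => by
      rw [neg_neg]
      exact (hact n hn).symm
    refine ⟨-u, k * g, hu.neg_left, hneg, activeOnly_smul hu.neg_left ?_ hact', hK2, hK6⟩
    rw [mul_neg]
    exact hkp.neg

end Admissible

namespace Admissible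

variable {N m K : ℕ} {a : Fin N → ℤ}

theorem residueSum_eq_one_of_lt (h : Admissible m a) (hN : 4 ≤ N) (h1 : residueSum m a 1 = 1)
    (hact : ActiveOnly m a K) (hK : 2 * K ≤ m) {n : ℕ} (hn : 1 ≤ n) (hnK : n < K) :
    residueSum m a n = 1 := by
  induction n, hn using Nat.le_induction with
  | base => exact_mod_cast h1
  | succ n hn ih =>
    rw [Nat.cast_succ]
    refine h.residueSum_add_eq_one hN (ih (by omega)) h1 h.one_mul_not_dvd
      (not_dvd_of_mem (by rw [Finset.mem_Ioo]; omega)) fun hc => ?_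
    have := hact.eq_or_eq (by omega) (by omega) (by omega) (by omega) hc
    omega

/-- Unless the multiples of `j` run into the active classes, they force `N - 1 ≤ 2`. -/
theorem dvd_or_dvd_of_not_dvd_mul (h : Admissible m a) (hN : 4 ≤ N) (h1 : residueSum m a 1 = 1)
    (hact : ActiveOnly m a K) (hK : 2 * K ≤ m) {j : ℕ} (hj : 1 ≤ j) (hjK : j < K)
    (hz : ∀ i, ¬ (m : ℤ) ∣ j * a i) : j ∣ K ∨ j ∣ m - K := by
  by_contra! hnd
  have hj1 := h.residueSum_eq_one_of_lt hN h1 hact hK hj hjK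
  have hmul (i : ℕ) (hi : 1 ≤ i) : i * j < m → residueSum m a ((i * j : ℕ) : ℤ) = 1 := by
    induction i, hi using Nat.le_induction with
    | base => simp [hj1]
    | succ i hi ih =>
      intro hlt
      rw [Nat.succ_mul] at hlt ⊢
      rw [Nat.cast_add]
      refine h.residueSum_add_eq_one hN (ih (by omega)) hj1 hz
        (not_dvd_of_mem (by rw [Finset.mem_Ioo]; omega)) fun hc => ?_
      rcases hact.eq_or_eq (by omega) (by omega) (by omega) (by omega) hc with he | he
      · exact hnd.1 ⟨i + 1, by rw [mul_comm, Nat.succ_mul]; omega⟩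
      · exact hnd.2 ⟨i + 1, by rw [mul_comm, Nat.succ_mul]; omega⟩
  obtain ⟨i, hi⟩ : ∃ i, (m - 1) / j = i + 1 :=
    Nat.exists_eq_succ_of_ne_zero (Nat.div_pos (by omega) hj).ne'
  have hi2 : 2 ≤ i + 1 := by
    rw [← hi, Nat.le_div_iff_mul_le hj]
    omega
  have hlt := Nat.div_add_mod (m - 1) j
  have hmod := Nat.mod_lt (m - 1) hj
  rw [hi, Nat.mul_succ, mul_comm] at hlt
  have hx := h.residueSum_eq_one_of_lt hN h1 hact hK (n := m - (i * j + j)) (by omega) (by omega)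
  have hij := hmul i (by omega) (by omega)
  have hadd := h.residueSum_add_le (i * j : ℕ) (m - (i * j + j) : ℕ)
  have hneg : residueSum m a ((i * j : ℕ) + (m - (i * j + j) : ℕ)) = residueSum m a (-j) :=
    residueSum_congr (Int.modEq_iff_dvd.2 ⟨-1, by omega⟩)
  rw [hneg, h.residueSum_neg hz] at hadd
  omega

end Admissible

/-- If the residue sums are `1` below `K`, then the third largest entry is less than `m / K`. -/
theorem mul_lt_of_listResidueSum_eq_one {m K A b c d e : ℕ} (hK : 3 ≤ K)
    (hsum : A + b + c + d + e = m) (hb : c ≤ b) (hc : d ≤ c) (hd : 1 ≤ d) (hA : b ≤ A)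
    (he : e ≤ d) (h : ∀ n, 1 ≤ n → n < K → listResidueSum m [A, b, c, d, e] n = 1) :
    2 * (b + c + d + e) ≤ m ∧ c * K < m := by
  simp only [listResidueSum, List.map_cons, List.map_nil, List.sum_cons, List.sum_nil] at h
  have hs : 2 * (b + c + d + e) ≤ m := by
    by_contra hlt
    have h2 := h 2 (by omega) (by omega)
    rw [Nat.mod_eq_of_lt (by omega), Nat.mod_eq_of_lt (by omega), Nat.mod_eq_of_lt (by omega),
      Nat.mod_eq_of_lt (by omega), Nat.mod_eq_of_lt (by omega),
      show 2 * A + (2 * b + (2 * c + (2 * d + (2 * e + 0)))) = 2 * m by omega,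
      Nat.mul_div_cancel _ (by omega)] at h2
    omega
  refine ⟨hs, ?_⟩
  obtain ⟨s, hs'⟩ : ∃ s, s = b + c + d + e := ⟨_, rfl⟩
  obtain ⟨i, hi⟩ : ∃ i, i = b / c := ⟨_, rfl⟩
  obtain ⟨j, hj⟩ : ∃ j, j = i * m / s + 1 := ⟨_, rfl⟩
  have hj1 : 1 ≤ j := hj ▸ Nat.succ_pos _
  have hi1 : 1 ≤ i := hi ▸ Nat.div_pos hb (by omega)
  have hib : i * c ≤ b := hi ▸ Nat.div_mul_le_self b c
  have hbi : b < 2 * (i * c) := by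
    have h1 := Nat.lt_div_mul_add (a := b) (b := c) (by omega)
    rw [← hi] at h1
    nlinarith
  have hjs : i * m < j * s := by
    rw [hj, Nat.succ_mul]
    exact Nat.lt_div_mul_add (by omega)
  have hjs' : j * s ≤ i * m + s := by
    rw [hj, Nat.succ_mul]
    exact Nat.add_le_add_right (Nat.div_mul_le_self _ _) s
  have hjb : j * b < i * m := by
    have h1 : b < 2 * i * (c + d + e) := by nlinarith
    have h2 : s * b < i * m * (c + d + e) := by nlinarith
    refine Nat.lt_of_mul_lt_mul_left (a := s) ?_
    have h3 : j * s * b ≤ (i * m + s) * b := Nat.mul_le_mul_right b hjs'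
    have h4 : i * m * s = i * m * b + i * m * (c + d + e) := by
      rw [← mul_add]
      congr 1
      omega
    linarith
  have hjc : j * c < m := by
    refine Nat.lt_of_mul_lt_mul_left (a := i) ?_
    have h3 : j * (i * c) ≤ j * b := Nat.mul_le_mul_left j hib
    linarith
  suffices hKj : K ≤ j by
    have := Nat.mul_le_mul_left c hKj
    linarith
  by_contra hlt
  have hF := h j hj1 (by omega)
  have hjd : j * d ≤ j * c := Nat.mul_le_mul_left j hc
  have hje : j * e ≤ j * d := Nat.mul_le_mul_left j he
  rw [Nat.mod_eq_of_lt hjc, Nat.mod_eq_of_lt (a := j * d) (by omega),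
    Nat.mod_eq_of_lt (a := j * e) (by omega)] at hF
  have hAq := Nat.div_add_mod (j * A) m
  have hbq := Nat.div_add_mod (j * b) m
  have hjA : j * A + j * s = m * j := by
    rw [← mul_add, mul_comm]
    congr 1
    omega
  have hA' : i + j * A / m < j := by
    refine Nat.lt_of_mul_lt_mul_left (a := m) ?_
    have := Nat.zero_le (j * A % m)
    linarith
  have hb' : j * b / m + 1 ≤ i := by
    rw [Nat.succ_le_iff, Nat.div_lt_iff_lt_mul (by omega)]
    exact hjb
  have h1 := Nat.mul_le_mul_left m (Nat.succ_le_of_lt hA')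
  have h2 := Nat.mul_le_mul_left m hb'
  have h3 : j * s = j * b + j * c + j * d + j * e := by rw [hs']; ring
  have hge : m * 2 ≤ j * A % m + (j * b % m + (j * c + (j * d + (j * e + 0)))) := by
    linarith
  have := Nat.div_le_div_right (c := m) hge
  rw [hF, Nat.mul_div_cancel_left _ (by omega)] at this
  omega

theorem exists_not_dvd_not_dvd {r s : ℕ} (hr : 2 ≤ r) (hs : 2 ≤ s) (x : ℕ) :
    ∃ a b, a < b ∧ b ≤ 5 ∧ ¬ r ∣ x + a ∧ ¬ s ∣ x + a ∧ ¬ r ∣ x + b ∧ ¬ s ∣ x + b := by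
  have hlarge {r : ℕ} (hr : 3 ≤ r) (y v : ℕ) (hv : 0 < v) (hv2 : v ≤ 2) (h : r ∣ y) :
      ¬ r ∣ y + v := fun h' => by
    have := Nat.le_of_dvd hv ((Nat.dvd_add_right h).1 h')
    omega
  have hodd {s : ℕ} (hs : 2 ≤ s) (y v : ℕ) (hy : y % 2 = 1) (hv : v = 2 ∨ v = 4) (h : s ∣ y) :
      ¬ s ∣ y + v := fun h' => by
    have hsv : s ∣ 2 ^ 2 := ((Nat.dvd_add_right h).1 h').trans
      (by rcases hv with rfl | rfl <;> norm_num)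
    obtain ⟨k, hk, rfl⟩ := (Nat.dvd_prime_pow Nat.prime_two).1 hsv
    have : 2 ∣ 2 ^ k := dvd_pow_self 2 (by rintro rfl; omega)
    have := this.trans h
    omega
  wlog hrs : r ≤ s generalizing r s
  · obtain ⟨a, b, h1, h2, h3, h4, h5, h6⟩ := this hs hr (by omega)
    exact ⟨a, b, h1, h2, h4, h3, h6, h5⟩
  obtain hr3 | rfl : 3 ≤ r ∨ 2 = r := by omega
  · have hone (y : ℕ) : ∃ a, a ≤ 2 ∧ ¬ r ∣ y + a ∧ ¬ s ∣ y + a := by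
      have h1 := hlarge hr3 y 1 (by omega) (by omega)
      have h2 := hlarge hr3 y 2 (by omega) (by omega)
      have h3 := hlarge hr3 (y + 1) 1 (by omega) (by omega)
      have h4 := hlarge (hr3.trans hrs) y 1 (by omega) (by omega)
      have h5 := hlarge (hr3.trans hrs) y 2 (by omega) (by omega)
      have h6 := hlarge (hr3.trans hrs) (y + 1) 1 (by omega) (by omega)
      by_contra! hall
      have h7 := hall 0 (by omega)
      have h8 := hall 1 (by omega)
      have h9 := hall 2 (by omega)
      simp only [add_zero, add_assoc, Nat.reduceAdd] at *
      tauto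
    obtain ⟨a, ha, har, has⟩ := hone x
    obtain ⟨b, hb, hbr, hbs⟩ := hone (x + 3)
    rw [add_assoc] at hbr hbs
    exact ⟨a, 3 + b, by omega, by omega, har, has, hbr, hbs⟩
  · obtain ⟨e, he, hxe⟩ : ∃ e, e ≤ 1 ∧ (x + e) % 2 = 1 := ⟨(x + 1) % 2, by omega, by omega⟩
    have h2 : ∀ v ∈ [0, 2, 4], ¬ 2 ∣ x + (e + v) := by
      intro v hv
      simp only [List.mem_cons, List.not_mem_nil, or_false] at hv
      omega
    have h3 := hodd hs (x + e) 2 hxe (by omega)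
    have h4 := hodd hs (x + e) 4 hxe (by omega)
    have h5 := hodd hs (x + e + 2) 2 (by omega) (by omega)
    simp only [add_assoc, Nat.reduceAdd] at h3 h4 h5
    by_cases h6 : s ∣ x + e
    · exact ⟨e + 2, e + 4, by omega, by omega, h2 2 (by simp), h3 h6, h2 4 (by simp), h4 h6⟩
    by_cases h7 : s ∣ x + (e + 2)
    · exact ⟨e, e + 4, by omega, by omega, h2 0 (by simp), h6, h2 4 (by simp), h5 h7⟩
    · exact ⟨e, e + 2, by omega, by omega, h2 0 (by simp), h6, h2 2 (by simp), h7⟩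

theorem lt_of_forall_dvd {m K r s : ℕ} (hr : 2 ≤ r) (hs : 2 ≤ s) (hK : 2 * K ≤ m)
    (hm : m ≤ 6 * K) (h : ∀ j, 1 ≤ j → j < K → r ∣ j ∨ s ∣ j ∨ j ∣ K ∨ j ∣ m - K) :
    K < 47 := by
  by_contra! hlt
  obtain ⟨x, rfl⟩ : ∃ x, K = x + 6 := ⟨K - 6, by omega⟩
  obtain ⟨a, b, hab, hb5, har, has, hbr, hbs⟩ := exists_not_dvd_not_dvd hr hs x
  have hdvd (a : ℕ) (ha : a ≤ 5) (har : ¬ r ∣ x + a) (has : ¬ s ∣ x + a) :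
      x + a ∣ m - (x + 6) := by
    rcases h (x + a) (by omega) (by omega) with hd | hd | ⟨k, hk⟩ | hd
    · exact absurd hd har
    · exact absurd hd has
    · rcases lt_or_ge k 2 with hk2 | hk2
      · interval_cases k <;> omega
      · nlinarith
    · exact hd
  obtain ⟨k, hk⟩ := hdvd a (by omega) har has
  obtain ⟨l, hl⟩ := hdvd b hb5 hbr hbs
  have hk5 : k ≤ 5 := by
    by_contra! hk5
    have := Nat.mul_le_mul_left (x + a) hk5
    omega
  have hl5 : l ≤ 5 := by
    by_contra! hl5
    have := Nat.mul_le_mul_left (x + b) hl5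
    omega
  interval_cases k <;> interval_cases l <;> omega

theorem listResidueSum_perm {l l' : List ℕ} (h : l.Perm l') (m n : ℕ) :
    listResidueSum m l n = listResidueSum m l' n := by
  rw [listResidueSum, listResidueSum, (h.map _).sum_eq]

theorem exists_sorted_of_length {l : List ℕ} (h4 : 4 ≤ l.length) (h5 : l.length ≤ 5)
    (hpos : ∀ x ∈ l, 1 ≤ x) :
    ∃ A b c d e, b ≤ A ∧ c ≤ b ∧ d ≤ c ∧ e ≤ d ∧ 1 ≤ d ∧ (∀ x ∈ l, x ∈ [A, b, c, d, e]) ∧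
      l.sum = A + b + c + d + e ∧
      ∀ m n, listResidueSum m l n = listResidueSum m [A, b, c, d, e] n := by
  have hp := List.perm_insertionSort (· ≥ ·) l
  have hsort := List.pairwise_insertionSort (· ≥ ·) l
  have hlen := hp.length_eq
  generalize l.insertionSort (· ≥ ·) = l' at hp hsort hlen
  simp only [← hp.mem_iff, ← hp.sum_eq, ← listResidueSum_perm hp] at hpos ⊢
  rw [← hlen] at h4 h5
  match l', h4, h5 with
  | [A, b, c, d], _, _ =>
    simp only [List.pairwise_cons, List.mem_cons, List.not_mem_nil, or_false] at hsort hpos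
    refine ⟨A, b, c, d, 0, hsort.1 b (by simp), hsort.2.1 c (by simp), hsort.2.2.1 d (by simp),
      Nat.zero_le _, hpos d (by simp), ?_, ?_, ?_⟩
    · simp only [List.mem_cons, List.not_mem_nil, or_false]
      tauto
    · simp [add_assoc]
    · simp [listResidueSum]
  | [A, b, c, d, e], _, _ =>
    simp only [List.pairwise_cons, List.mem_cons, List.not_mem_nil, or_false] at hsort hpos
    exact ⟨A, b, c, d, e, hsort.1 b (by simp), hsort.2.1 c (by simp), hsort.2.2.1 d (by simp),
      hsort.2.2.2.1 e (by simp), hpos d (by simp), by simp, by simp [add_assoc],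
      fun _ _ => rfl⟩

theorem exists_dvd_mul_iff {m x : ℕ} (hx : 1 ≤ x) (hxm : x < m) :
    ∃ r, 2 ≤ r ∧ r ∣ m ∧ ∀ j, m ∣ j * x ↔ r ∣ j := by
  obtain ⟨g, r, x', hg, hcop, rfl, rfl⟩ :=
    Nat.exists_coprime' (Nat.gcd_pos_of_pos_right m hx)
  have h1 := Nat.lt_of_mul_lt_mul_right hxm
  have h2 := Nat.pos_of_mul_pos_right hx
  refine ⟨r, by omega, dvd_mul_right r g, fun j => ?_⟩
  rw [← mul_assoc, Nat.mul_dvd_mul_iff_right hg, hcop.dvd_mul_right]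

theorem coprimesDivide_of_forall_dvd {m K r s : ℕ} (hr : 2 ≤ r) (hrm : r ∣ m)
    (hs : 2 ≤ s) (hsm : s ∣ m)
    (h : ∀ j, 1 ≤ j → j < K → r ∣ j ∨ s ∣ j ∨ j ∣ K ∨ j ∣ m - K) : coprimesDivide K m := by
  simp only [coprimesDivide, List.all_eq_true, List.mem_range, Bool.or_eq_true, beq_iff_eq,
    bne_iff_ne, ← Nat.dvd_iff_mod_eq_zero]
  intro j hjK
  rcases Nat.eq_zero_or_pos j with hj | hj
  · simp [hj]
  rcases h j hj hjK with hd | hd | hd | hd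
  · exact Or.inr (Nat.not_coprime_of_dvd_of_dvd hr hd hrm)
  · exact Or.inr (Nat.not_coprime_of_dvd_of_dvd hs hd hsm)
  · exact Or.inl (Or.inl (Or.inr hd))
  · exact Or.inl (Or.inr hd)

namespace Admissible

variable {N m K : ℕ} {a : Fin N → ℤ}

theorem not_activeOnly_of_mem_Icc (h : Admissible m a) (hN : 4 ≤ N) (hN5 : N ≤ 5)
    {t : ℤ} (ht : IsCoprime t m) (hF : residueSum m a t = 1)
    (hm : 13 ≤ m) (hK : 2 * K ≤ m) (hK6 : m ≤ 6 * K) :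
    ¬ ActiveOnly m (fun i => t * a i % m) K := by
  intro hact
  have hb := h.smul ht
  have hb1 : residueSum m (fun i => t * a i % m) 1 = 1 := by rw [residueSum_smul, one_mul, hF]
  obtain ⟨l, -, hla⟩ := h.exists_isListing ht (v := 1) hF
  have hmem (i : Fin N) : ∃ x ∈ l, t * a i % m = (x : ℕ) := by
    have hi : t * a i % m ∈ Finset.univ.val.map fun i => t * a i % m :=
      Multiset.mem_map_of_mem _ (Finset.mem_univ i)
    rw [hla, Multiset.mem_coe, List.mem_map] at hi
    obtain ⟨x, hx, hxi⟩ := hi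
    exact ⟨x, hx, hxi.symm⟩
  have hpos : ∀ x ∈ l, 1 ≤ x := by
    intro x hx
    have hx' : (x : ℤ) ∈ Finset.univ.val.map fun i => t * a i % m := by
      rw [hla, Multiset.mem_coe]
      exact List.mem_map_of_mem hx
    obtain ⟨i, -, hi⟩ := Multiset.mem_map.1 hx'
    by_contra! hlt
    obtain rfl : x = 0 := by omega
    exact hb.not_dvd i (by simp [hi])
  have hlsum : l.sum = m := by
    have h1 := hla.sum_eq
    rw [← h.mul_residueSum, hF] at h1
    omega
  have hlen := hla.length_eq
  obtain ⟨A, b, c, d, e, hAb, hbc, hcd, hde, hd, hsub, hsum, hres⟩ :=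
    exists_sorted_of_length (by omega) (by omega) hpos
  have hFl (n : ℕ) : residueSum m (fun i => t * a i % m) n =
      listResidueSum m [A, b, c, d, e] n := by
    rw [hla.residueSum_eq, hres]
  obtain ⟨hs, hcK⟩ := mul_lt_of_listResidueSum_eq_one (m := m) (K := K) (by omega) (by omega)
    hbc hcd hd hAb hde fun n hn hnK => by
      have := hb.residueSum_eq_one_of_lt hN hb1 hact hK hn hnK
      rw [hFl] at this
      exact_mod_cast this
  obtain ⟨r, hr, hrm, hrA⟩ := exists_dvd_mul_iff (m := m) (x := A) (by omega) (by omega)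
  obtain ⟨s, hs2, hsm, hsb⟩ := exists_dvd_mul_iff (m := m) (x := b) (by omega) (by omega)
  have hcover (j : ℕ) (hj : 1 ≤ j) (hjK : j < K) :
      r ∣ j ∨ s ∣ j ∨ j ∣ K ∨ j ∣ m - K := by
    rw [← hrA, ← hsb]
    by_contra! hne
    refine not_or.2 hne.2.2 (hb.dvd_or_dvd_of_not_dvd_mul hN hb1 hact hK hj hjK fun i hi => ?_)
    obtain ⟨x, hx, hxi⟩ := hmem i
    have hx1 := hpos x hx
    have hx2 := hsub x hx
    have hmx : m ∣ j * x := by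
      simp only [hxi] at hi
      exact_mod_cast hi
    simp only [List.mem_cons, List.not_mem_nil, or_false] at hx2
    have hxc : x ≤ c := by
      rcases hx2 with rfl | rfl | rfl | rfl | rfl
      · exact absurd hmx hne.1
      · exact absurd hmx hne.2.1
      all_goals omega
    have h1 := Nat.le_of_dvd (Nat.mul_pos hj hx1) hmx
    have h2 := Nat.mul_le_mul hjK.le hxc
    rw [mul_comm K] at h2
    omega
  have hK47 := lt_of_forall_dvd hr hs2 hK hK6 hcover
  have hcov := coprimesDivide_of_forall_dvd hr hrm hs2 hsm hcover
  have hno := noLongTuple_of_coprimesDivide K (by simpa using hK47) (by omega) m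
    (by simp; omega) hm hK hcov
  have hlist := hb.listActiveOnly hact (by omega) (by omega) hFl
  obtain rfl : A = m - b - c - d - e := by omega
  simp only [noLongTuple, List.all_eq_true, List.mem_range, Bool.or_eq_true, beq_iff_eq,
    decide_eq_true_eq, Bool.not_eq_true'] at hno
  have hfalse := (hno c (by rw [Nat.lt_succ_iff, Nat.le_div_iff_mul_le (by omega)]; omega))
    |>.resolve_left (by omega) d (by omega)
  have hfalse := hfalse.resolve_left (by omega) e (by omega) b (by omega)
  rw [hlist] at hfalse
  simp at hfalse
  omega

end Admissible

/-- Every solution is equivalent to one of the twenty triples. -/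
theorem Admissible.isKnown {N m : ℕ} {a : Fin N → ℤ} (h : Admissible m a) (hN : 4 ≤ N)
    (hs : CondStar m N a) : IsKnown m a := by
  by_cases hne : ∀ t : ℤ, IsCoprime t m → residueSum m a t ≠ 1
  · exact h.isKnown_of_forall_residueSum_ne_one hN hs hne
  push Not at hne
  obtain ⟨t, ht, hF⟩ := hne
  obtain ⟨hN5, p, hp, hpm, hact⟩ := h.exists_activeOnly_smul hN hs ht hF
  have hb := h.smul ht
  rcases lt_or_ge m 13 with hm | hm
  · obtain ⟨l, hl, hla⟩ := h.exists_isListing ht (v := 1) hF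
    rw [mul_one] at hl
    refine IsKnown.of_smul ht (hla.isKnown (inTwentyTriples_of_sum_eq m (List.mem_range.2 hm) l hl
      (by rwa [hla.length_eq]) (by rwa [hla.length_eq]) p (List.mem_range.2 hpm) ?_))
    exact hb.listActiveOnly hact hp hpm (hla.residueSum_eq m)
  · obtain ⟨u, K, hu, hF', hactK, hK, hK6⟩ := hb.exists_activeOnly_mem_Icc hp hpm hact hm
    exact absurd hactK (hb.not_activeOnly_of_mem_Icc hN hN5 hu hF' hm hK hK6)

theorem IsTriple.admissible {m N : ℕ} {a : Fin N → ℤ} (h : IsTriple m N a) :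
    Admissible (m : ℤ) a := by
  obtain ⟨hm, -, ha, hgcd, hsum⟩ := h
  refine ⟨by exact_mod_cast hm, fun i hd => ?_, fun n hn => ?_, hsum⟩
  · have := Int.le_of_dvd (by linarith [ha i]) hd
    linarith [ha i]
  · have hd : (m : ℤ) ∣ n * Finset.univ.gcd a :=
      (Finset.gcd_mul_left' _ _ n).dvd_iff_dvd_right.1 (Finset.dvd_gcd fun i _ => hn i)
    exact (Int.isCoprime_iff_gcd_eq_one.2 hgcd).dvd_of_dvd_mul_right hd

theorem EquivTuple.trans {m N : ℕ} {a b c : Fin N → ℤ} (hab : EquivTuple m N a b)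
    (hbc : EquivTuple m N b c) : EquivTuple m N a c := by
  obtain ⟨t, ht, σ, hσ⟩ := hab
  obtain ⟨u, hu, τ, hτ⟩ := hbc
  refine ⟨u * t, ?_, τ.trans σ, fun i => ?_⟩
  · rw [← Int.isCoprime_iff_gcd_eq_one] at *
    exact hu.mul_left ht
  · rw [mul_assoc]
    exact (hτ i).trans ((hσ (τ i)).mul_left u)

theorem EquivTuple.symm {m N : ℕ} {a b : Fin N → ℤ} (hab : EquivTuple m N a b) :
    EquivTuple m N b a := by
  obtain ⟨t, ht, σ, hσ⟩ := hab
  obtain ⟨u, v, huv⟩ := Int.isCoprime_iff_gcd_eq_one.2 ht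
  refine ⟨u, Int.isCoprime_iff_gcd_eq_one.1 ⟨t, v, by linear_combination huv⟩, σ.symm,
    fun i => ?_⟩
  refine Int.ModEq.trans ?_ ((hσ (σ.symm i)).mul_left u).symm
  rw [Equiv.apply_symm_apply]
  exact Int.modEq_iff_dvd.2 ⟨-v * a i, by linear_combination a i * huv⟩

theorem isListing_get_cast {N : ℕ} {l : List ℕ} (h : N = l.length) :
    IsListing (fun i : Fin N => (l.get (Fin.cast h i) : ℤ)) l := by
  subst h
  rw [IsListing, Fin.univ_val_map]
  congr 1
  conv_rhs => rw [← List.ofFn_get l]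
  rw [List.map_ofFn]
  rfl

theorem IsKnown.exists_equivTuple {m N : ℕ} {a : Fin N → ℤ} (h : IsKnown m a) :
    ∃ p ∈ twentyTriples, m = p.1 ∧ ∃ hN : N = p.2.length,
      EquivTuple m N a (fun i => (p.2.get (Fin.cast hN i) : ℤ)) := by
  obtain ⟨p, hp, hpm, t, ht, hl⟩ := h
  refine ⟨p, hp, hpm.symm, hl.length_eq.symm, t, Int.isCoprime_iff_gcd_eq_one.1 ht, ?_⟩
  obtain ⟨σ, hσ⟩ := exists_perm_of_map_eq (f := fun i => t * a i % m)
    (g := fun i => (p.2.get (Fin.cast hl.length_eq.symm i) : ℤ))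
    (hl.trans (isListing_get_cast hl.length_eq.symm).symm)
  exact ⟨σ, fun i => (congrArg (· % (m : ℤ)) (hσ i)).trans (Int.mod_modEq _ _)⟩

theorem EquivTriple.eq {p q : ℕ × List ℕ} (hp : p ∈ twentyTriples) (hq : q ∈ twentyTriples)
    (h : EquivTriple p q) : p = q := by
  obtain ⟨hpq, hlen, t, ht, σ, hσ⟩ := h
  have hlt : ∀ q ∈ twentyTriples, 0 < q.1 ∧ ∀ x ∈ q.2, x < q.1 := by decide +kernel
  have hp0 := (hlt p hp).1
  obtain ⟨u, hu⟩ := Int.eq_ofNat_of_zero_le (Int.emod_nonneg t (b := p.1) (by omega))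
  have hut : (u : ℤ) ≡ t [ZMOD p.1] := by
    rw [← hu]
    exact Int.mod_modEq _ _
  have hup : u < p.1 := by
    have := Int.emod_lt_of_pos t (b := p.1) (by omega)
    omega
  have hgcd : Nat.gcd u p.1 = 1 := by
    rw [← Int.gcd_natCast_natCast, ← hu, Int.gcd_emod, ht]
  refine isPerm_eq_of_mem_twentyTriples p hp q hq hpq u (List.mem_range.2 hup) hgcd
    (List.isPerm_iff.2 (Multiset.coe_eq_coe.1 ?_))
  apply Multiset.map_injective (Nat.cast_injective (R := ℤ))
  rw [Multiset.map_coe, Multiset.map_coe, ← (isListing_get_cast rfl).map_mul_emod p.1 u,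
    ← isListing_get_cast hlen.symm]
  conv_lhs => rw [← Multiset.map_univ_val_equiv σ, Multiset.map_map]
  refine Multiset.map_congr rfl fun i _ => ?_
  have hi := (hσ i).trans (hut.symm.mul_right _)
  have hqi : q.2.get (Fin.cast hlen.symm i) < p.1 := hpq ▸ (hlt q hq).2 _ (List.get_mem _ _)
  exact Eq.trans hi.symm (Int.emod_eq_of_lt (Int.natCast_nonneg _) (Int.ofNat_lt.2 hqi))

/-- The twenty triples are pairwise inequivalent; consequently, condition (⋆) has precisely
twenty solutions up to equivalence: every triple satisfying the hypotheses and (⋆) is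
equivalent to exactly one of the twenty triples. -/
theorem twenty_triples_pairwise_inequivalent :
    (∀ p ∈ twentyTriples, ∀ q ∈ twentyTriples, p ≠ q → ¬ EquivTriple p q) ∧
    (∀ (m N : ℕ) (a : Fin N → ℤ), IsTriple m N a → CondStar m N a →
      ∃! p : ℕ × List ℕ, p ∈ twentyTriples ∧ m = p.1 ∧ ∃ hN : N = p.2.length,
        EquivTuple m N a (fun i => (p.2.get (Fin.cast hN i) : ℤ))) := by
  refine ⟨fun p hp q hq hne h => hne (h.eq hp hq), fun m N a h hs => ?_⟩
  obtain ⟨p, hp, hm, hN, hpa⟩ := (h.admissible.isKnown h.2.1 hs).exists_equivTuple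
  refine ⟨p, ⟨hp, hm, hN, hpa⟩, fun q ⟨hq, hm', hN', hqa⟩ => ?_⟩
  subst hm hN
  exact (EquivTriple.eq hp hq ⟨hm', hN'.symm, hpa.symm.trans hqa⟩).symm
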